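/- arXiv:2210.04070 — 2 statements merged into one kernel-verified Lean document; each statement's English description precedes it below -/
import Mathlib

section
/- If N ≥ 2, d ≥ max{63, 46N−79}, and n ≥ 7d+14, then q_d^{(1)}(n) ≥ Q_{d−N}^{(1,−)}(n). -/
/-- `rho A n` is the number of partitions of `n` all of whose parts lie in `A`. -/
noncomputable def rho (A : Set ℕ) (n : ℕ) : ℕ :=
  Nat.card {p : n.Partition // ∀ x ∈ p.parts, x ∈ A}

/-- `qpart a d n` is the number of partitions of `n` into parts that are all `≥ a`
and pairwise differ by at least `d` (so, in particular, are distinct when `d ≥ 1`). -/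
noncomputable def qpart (a d n : ℕ) : ℕ :=
  Nat.card {p : n.Partition //
    (∀ x ∈ p.parts, a ≤ x) ∧
    (∀ x ∈ p.parts, p.parts.count x ≤ 1) ∧
    (∀ x ∈ p.parts, ∀ y ∈ p.parts, x ≠ y → d ≤ max x y - min x y)}

/-- Positive integers congruent to `±a` modulo `m`, excluding `m - a`. -/
noncomputable def QminusSet (a m : ℕ) : Set ℕ :=
  {x | x % m = a % m ∨ x % m = (m - a) % m} \ {m - a}

/-- `Qminus a d n` counts partitions of `n` into parts `≡ ±a (mod d+3)`,
excluding the part `d+3-a`. -/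
noncomputable def Qminus (a d n : ℕ) : ℕ := rho (QminusSet a (d + 3)) n

/-- `Qmm a d n` counts partitions of `n` into parts `≡ ±a (mod d+3)`,
excluding both the parts `a` and `d+3-a`. -/
noncomputable def Qmm (a d n : ℕ) : ℕ := rho (QminusSet a (d + 3) \ {a}) n

/-- `Tset s d` is the set of naturals congruent to `1` or to `d + 2^j` for some
`1 ≤ j ≤ s - 1` modulo `2d`. -/
def Tset (s d : ℕ) : Set ℕ :=
  {y | y % (2 * d) = 1 % (2 * d) ∨
    ∃ j, 1 ≤ j ∧ j + 1 ≤ s ∧ y % (2 * d) = (d + 2 ^ j) % (2 * d)}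

/-- `T5 d` : naturals congruent to `1, d+2, d+4, d+8` or `d+16` modulo `2d`. -/
def T5 (d : ℕ) : Set ℕ := Tset 5 d

/-- `Sset d N` : naturals congruent to `±1` modulo `d-N+3`, excluding `d-N+2`. -/
def Sset (d N : ℕ) : Set ℕ :=
  {x | x % (d - N + 3) = 1 % (d - N + 3) ∨ x % (d - N + 3) = (d - N + 2) % (d - N + 3)}
    \ {d - N + 2}

/-- `xN d N i` is the `i`-th smallest element of `Sset d N` (1-indexed). -/
noncomputable def xN (d N i : ℕ) : ℕ := Nat.nth (· ∈ Sset d N) (i - 1)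

/-- `yT d i` is the `i`-th smallest element of `T5 d` (1-indexed). -/
noncomputable def yT (d i : ℕ) : ℕ := Nat.nth (· ∈ T5 d) (i - 1)

open Finset in
/-- Euler's product over parts at most `n`, bounded through `ζ(2)`. -/
lemma sum_neg_log_one_sub_pow_le {y : ℝ} (hy0 : 0 < y) (hy1 : y < 1) (n : ℕ) :
    ∑ c ∈ Icc 1 n, -Real.log (1 - y ^ c) ≤ Real.pi ^ 2 / 6 * (y / (1 - y)) := by
  have hlog : ∀ c ∈ Icc 1 n,
      HasSum (fun i : ℕ => (y ^ c) ^ (i + 1) / ((i : ℝ) + 1)) (-Real.log (1 - y ^ c)) := by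
    intro c hc
    have hc1 : c ≠ 0 := by have := (mem_Icc.1 hc).1; omega
    apply Real.hasSum_pow_div_log_of_abs_lt_one
    rw [abs_of_pos (by positivity)]
    exact pow_lt_one₀ hy0.le hy1 hc1
  have hzeta : HasSum (fun i : ℕ => 1 / ((i : ℝ) + 1) ^ 2 * (y / (1 - y)))
      (Real.pi ^ 2 / 6 * (y / (1 - y))) := by
    have h := (hasSum_nat_add_iff' 1).2 hasSum_zeta_two
    simp only [Finset.sum_range_one, Nat.cast_zero, Nat.cast_add, Nat.cast_one] at h
    norm_num at h
    have h' := h.mul_right (y / (1 - y))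
    simpa using h'
  refine hasSum_le (fun i => ?_) (hasSum_sum hlog) hzeta
  have hi : (0 : ℝ) < (i : ℝ) + 1 := by positivity
  have hy1' : 0 < 1 - y := by linarith
  set z := y ^ (i + 1) with hz
  have hz0 : 0 < z := by positivity
  have hz1 : z < 1 := pow_lt_one₀ hy0.le hy1 (by omega)
  have hgeom : ∑ c ∈ Icc 1 n, z ^ c ≤ z / (1 - z) := by
    rw [le_div_iff₀ (by linarith)]
    have : ∀ n : ℕ, (∑ c ∈ Icc 1 n, z ^ c) * (1 - z) = z - z ^ (n + 1) := by
      intro n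
      induction n with
      | zero => simp
      | succ n ih => rw [sum_Icc_succ_top (by omega), add_mul, ih]; ring
    rw [this]
    linarith [pow_pos hz0 (n + 1)]
  have hratio : z / (1 - z) ≤ y / (1 - y) / ((i : ℝ) + 1) := by
    rw [div_div, div_le_div_iff₀ (by linarith) (by positivity)]
    have hfac : 1 - z = (1 - y) * ∑ k ∈ range (i + 1), y ^ k := (mul_neg_geom_sum y (i + 1)).symm
    have hsum : ((i : ℝ) + 1) * y ^ i ≤ ∑ k ∈ range (i + 1), y ^ k := by
      have := card_nsmul_le_sum (range (i + 1)) (fun k => y ^ k) (y ^ i) (fun k hk =>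
        pow_le_pow_of_le_one hy0.le hy1.le (by have := mem_range.1 hk; omega))
      simpa using this
    rw [hfac, hz, pow_succ]
    nlinarith [mul_le_mul_of_nonneg_left hsum (mul_pos hy1' hy0).le]
  calc ∑ c ∈ Icc 1 n, (y ^ c) ^ (i + 1) / ((i : ℝ) + 1)
      = (∑ c ∈ Icc 1 n, z ^ c) / ((i : ℝ) + 1) := by
        rw [sum_div]
        exact sum_congr rfl fun c _ => by rw [hz, pow_right_comm]
    _ ≤ y / (1 - y) / ((i : ℝ) + 1) / ((i : ℝ) + 1) := by
        gcongr
        exact hgeom.trans hratio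
    _ = 1 / ((i : ℝ) + 1) ^ 2 * (y / (1 - y)) := by field_simp

lemma exp_pi_sq_div_six_le : Real.exp (Real.pi ^ 2 / 6) ≤ 26 / 5 := by
  have hpi : Real.pi ^ 2 / 6 ≤ 28 / 17 := by
    nlinarith [Real.pi_lt_d4, Real.pi_pos]
  have h1 : Real.exp (28 / 17) ^ 17 = Real.exp 1 ^ 28 := by
    rw [← Real.exp_nat_mul, ← Real.exp_nat_mul]; norm_num
  have h2 : Real.exp 1 ^ 28 ≤ (2.7182818286 : ℝ) ^ 28 :=
    pow_le_pow_left₀ (Real.exp_pos 1).le Real.exp_one_lt_d9.le 28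
  have h3 : (2.7182818286 : ℝ) ^ 28 ≤ (26 / 5) ^ 17 := by norm_num
  refine (Real.exp_le_exp.2 hpi).trans ?_
  exact le_of_pow_le_pow_left₀ (by norm_num : (17 : ℕ) ≠ 0) (by norm_num)
    (h1.le.trans (h2.trans h3))

lemma exp_three_halves_le : Real.exp (3 / 2) ≤ 9 / 2 := by
  have h1 : Real.exp (3 / 2) ^ 2 = Real.exp 1 ^ 3 := by
    rw [← Real.exp_nat_mul, ← Real.exp_nat_mul]; norm_num
  have h2 : Real.exp 1 ^ 3 ≤ (2.7182818286 : ℝ) ^ 3 :=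
    pow_le_pow_left₀ (Real.exp_pos 1).le Real.exp_one_lt_d9.le 3
  have h3 : (2.7182818286 : ℝ) ^ 3 ≤ (9 / 2) ^ 2 := by norm_num
  exact le_of_pow_le_pow_left₀ two_ne_zero (by norm_num) (h1.le.trans (h2.trans h3))

lemma factorial_mul_pow_le {j : ℕ} (hj : 7 ≤ j) :
    (26 / 5 : ℝ) ^ (j + 1) * (9 / 2) ^ (j + 2) * (j.factorial * (j + 1).factorial) ≤
      (14 * (j * (j + 1))) ^ j := by
  induction j, hj using Nat.le_induction with
  | base => norm_num [Nat.factorial]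
  | succ j hj ih =>
    have hj0 : (0 : ℝ) < j := by positivity
    have hbern : 3 * (j : ℝ) ^ j ≤ ((j : ℝ) + 2) ^ j := by
      have h := one_add_mul_le_pow (a := 2 / (j : ℝ)) (by linarith [div_pos two_pos hj0]) j
      have h3 : 1 + (j : ℝ) * (2 / j) = 3 := by field_simp; norm_num
      rw [h3] at h
      calc 3 * (j : ℝ) ^ j ≤ (1 + 2 / (j : ℝ)) ^ j * j ^ j := by gcongr
        _ = ((j : ℝ) + 2) ^ j := by rw [← mul_pow]; congr 1; field_simp
    have hstep : (26 / 5 : ℝ) ^ (j + 1 + 1) * (9 / 2) ^ (j + 1 + 2) *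
        ((j + 1).factorial * (j + 1 + 1).factorial) =
        (26 / 5 : ℝ) ^ (j + 1) * (9 / 2) ^ (j + 2) * (j.factorial * (j + 1).factorial) *
          (117 / 5 * (((j : ℝ) + 1) * (j + 2))) := by
      rw [Nat.factorial_succ (j + 1), Nat.factorial_succ j]
      push_cast
      ring
    rw [hstep]
    calc _ ≤ (14 * ((j : ℝ) * (j + 1))) ^ j * (117 / 5 * (((j : ℝ) + 1) * (j + 2))) := by gcongr
      _ ≤ (14 * ((j : ℝ) * (j + 1))) ^ j * (14 * 3 * (((j : ℝ) + 1) * (j + 2))) := by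
          gcongr; norm_num
      _ = 14 ^ (j + 1) * ((j : ℝ) + 1) ^ (j + 1) * (j + 2) * (3 * (j : ℝ) ^ j) := by
          simp only [mul_pow]; ring
      _ ≤ 14 ^ (j + 1) * ((j : ℝ) + 1) ^ (j + 1) * (j + 2) * ((j : ℝ) + 2) ^ j := by gcongr
      _ = (14 * (((j + 1 : ℕ) : ℝ) * ((j + 1 : ℕ) + 1))) ^ (j + 1) := by
          push_cast
          simp only [mul_pow]
          ring

/-- The `k`-element sets of positive integers with sum `n` whose elements pairwise differ by at
least `d`. -/
def spacedSets (d k n : ℕ) : Finset (Finset ℕ) :=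
  (Finset.Icc 1 n).powerset.filter fun s =>
    s.card = k ∧ ∑ x ∈ s, x = n ∧ ∀ x ∈ s, ∀ y ∈ s, x < y → x + d ≤ y

lemma mem_spacedSets {d k n : ℕ} {s : Finset ℕ} :
    s ∈ spacedSets d k n ↔ (∀ x ∈ s, 1 ≤ x) ∧ s.card = k ∧ ∑ x ∈ s, x = n ∧
      ∀ x ∈ s, ∀ y ∈ s, x < y → x + d ≤ y := by
  simp only [spacedSets, Finset.mem_filter, Finset.mem_powerset]
  refine and_congr_left fun ⟨_, hsum, _⟩ => ⟨fun h x hx => (Finset.mem_Icc.1 (h hx)).1,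
    fun h x hx => Finset.mem_Icc.2 ⟨h x hx, ?_⟩⟩
  rw [← hsum]
  exact Finset.single_le_sum (f := fun x => x) (fun _ _ => Nat.zero_le _) hx

lemma insert_one_map_mem_spacedSets {d k n : ℕ} {s : Finset ℕ} (hd : 1 ≤ d)
    (hs : s ∈ spacedSets d k n) :
    insert 1 (s.map (addRightEmbedding d)) ∈ spacedSets d (k + 1) (n + d * k + 1) := by
  rw [mem_spacedSets] at hs ⊢
  obtain ⟨h1, h2, h3, h4⟩ := hs
  have hnot : 1 ∉ s.map (addRightEmbedding d) := by
    simp only [Finset.mem_map, addRightEmbedding_apply, not_exists, not_and]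
    intro x hx
    have := h1 x hx
    omega
  refine ⟨?_, ?_, ?_, ?_⟩
  · intro x hx
    simp only [Finset.mem_insert, Finset.mem_map, addRightEmbedding_apply] at hx
    rcases hx with rfl | ⟨y, hy, rfl⟩ <;> omega
  · rw [Finset.card_insert_of_notMem hnot, Finset.card_map, h2]
  · rw [Finset.sum_insert hnot, Finset.sum_map]
    simp only [addRightEmbedding_apply, Finset.sum_add_distrib, Finset.sum_const, h2, h3,
      smul_eq_mul]
    ring
  · intro x hx y hy hxy
    simp only [Finset.mem_insert, Finset.mem_map, addRightEmbedding_apply] at hx hy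
    rcases hx with rfl | ⟨a, ha, rfl⟩ <;> rcases hy with rfl | ⟨b, hb, rfl⟩
    · omega
    · have := h1 b hb; omega
    · omega
    · have := h4 a ha b hb (by omega); omega

lemma map_succ_mem_spacedSets {d k n : ℕ} {s : Finset ℕ} (hs : s ∈ spacedSets d k n) :
    s.map (addRightEmbedding 1) ∈ spacedSets d k (n + k) := by
  rw [mem_spacedSets] at hs ⊢
  obtain ⟨h1, h2, h3, h4⟩ := hs
  refine ⟨?_, ?_, ?_, ?_⟩
  · intro x hx
    simp only [Finset.mem_map, addRightEmbedding_apply] at hx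
    obtain ⟨y, -, rfl⟩ := hx
    omega
  · rw [Finset.card_map, h2]
  · rw [Finset.sum_map]
    simp only [addRightEmbedding_apply, Finset.sum_add_distrib, Finset.sum_const, h2, h3,
      smul_eq_mul, mul_one]
  · intro x hx y hy hxy
    simp only [Finset.mem_map, addRightEmbedding_apply] at hx hy
    obtain ⟨a, ha, rfl⟩ := hx
    obtain ⟨b, hb, rfl⟩ := hy
    have := h4 a ha b hb (by omega)
    omega

lemma insert_one_map_injOn {d k n : ℕ} (hd : 1 ≤ d) :
    Set.InjOn (fun s : Finset ℕ => insert 1 (s.map (addRightEmbedding d)))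
      (spacedSets d k n : Set (Finset ℕ)) := by
  intro s hs t ht hst
  have hnot : ∀ u ∈ spacedSets d k n, 1 ∉ u.map (addRightEmbedding d) := by
    intro u hu
    simp only [Finset.mem_map, addRightEmbedding_apply, not_exists, not_and]
    intro x hx
    have := (mem_spacedSets.1 hu).1 x hx
    omega
  have h := congrArg (fun u : Finset ℕ => u.erase 1) hst
  simp only [Finset.erase_insert (hnot s hs), Finset.erase_insert (hnot t ht)] at h
  exact Finset.map_injective _ h

lemma card_spacedSets_le_succ {d k n : ℕ} (hd : 1 ≤ d) :
    (spacedSets d k n).card ≤ (spacedSets d (k + 1) (n + d * k + 1)).card :=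
  Finset.card_le_card_of_injOn _ (fun _ hs => insert_one_map_mem_spacedSets hd hs)
    (insert_one_map_injOn hd)

lemma card_spacedSets_add_le {d k n n' : ℕ} (hd : 1 ≤ d) (h : n + d * k + 1 = n' + (k + 1)) :
    (spacedSets d k n).card + (spacedSets d (k + 1) n').card ≤
      (spacedSets d (k + 1) (n + d * k + 1)).card := by
  rw [← Finset.card_image_of_injOn (insert_one_map_injOn hd),
    ← Finset.card_image_of_injective (spacedSets d (k + 1) n')
      (Finset.map_injective (addRightEmbedding 1)), ← Finset.card_union_of_disjoint]
  · apply Finset.card_le_card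
    intro s hs
    rcases Finset.mem_union.1 hs with hs | hs
    · obtain ⟨t, ht, rfl⟩ := Finset.mem_image.1 hs
      exact insert_one_map_mem_spacedSets hd ht
    · obtain ⟨t, ht, rfl⟩ := Finset.mem_image.1 hs
      rw [h]
      exact map_succ_mem_spacedSets ht
  · rw [Finset.disjoint_left]
    intro s hs hs'
    obtain ⟨t, -, rfl⟩ := Finset.mem_image.1 hs
    obtain ⟨t', ht', heq⟩ := Finset.mem_image.1 hs'
    have h1 : 1 ∈ t'.map (addRightEmbedding 1) := by
      rw [heq]; exact Finset.mem_insert_self _ _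
    obtain ⟨x, hx, hx1⟩ := Finset.mem_map.1 h1
    have := (mem_spacedSets.1 ht').1 x hx
    simp only [addRightEmbedding_apply] at hx1
    omega

lemma pow_succ_le_mul_pow_add_pow (j a b : ℕ) :
    (a + b) ^ (j + 1) ≤ (j + 1) * b * (a + b) ^ j + a ^ (j + 1) := by
  induction j with
  | zero => simp; omega
  | succ j ih =>
    have h : a ^ (j + 1) ≤ (a + b) ^ (j + 1) := Nat.pow_le_pow_left (by omega) _
    calc (a + b) ^ (j + 1 + 1) = (a + b) * (a + b) ^ (j + 1) := by ring
      _ ≤ (a + b) * ((j + 1) * b * (a + b) ^ j + a ^ (j + 1)) := by gcongr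
      _ = (j + 1) * b * (a + b) ^ (j + 1) + b * a ^ (j + 1) + a ^ (j + 1 + 1) := by ring
      _ ≤ (j + 1) * b * (a + b) ^ (j + 1) + b * (a + b) ^ (j + 1) + a ^ (j + 1 + 1) := by gcongr
      _ = (j + 1 + 1) * b * (a + b) ^ (j + 1) + a ^ (j + 1 + 1) := by ring

lemma pow_le_factorial_mul_card_spacedSets {d : ℕ} (hd : 1 ≤ d) (j M : ℕ) :
    M ^ j ≤ j.factorial * (j + 1).factorial *
      (spacedSets d (j + 1) (M + (j + 1) + d * (j + 1).choose 2)).card := by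
  induction j generalizing M with
  | zero =>
    have hmem : {M + 1} ∈ spacedSets d 1 (M + 1) := by
      rw [mem_spacedSets]; simp
    have := Finset.card_pos.2 ⟨_, hmem⟩
    simpa using this
  | succ j ihj =>
    have hidx : ∀ M, M + (j + 1 + 1) + d * (j + 1 + 1).choose 2 =
        M + (j + 1) + d * (j + 1).choose 2 + d * (j + 1) + 1 := by
      intro M
      rw [Nat.choose_succ_succ' (j + 1) 1, Nat.choose_one_right]
      ring
    have hfac : (j + 1).factorial * (j + 1 + 1).factorial =
        (j + 1) * (j + 2) * (j.factorial * (j + 1).factorial) := by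
      rw [Nat.factorial_succ (j + 1), Nat.factorial_succ j]; ring
    induction M using Nat.strong_induction_on with
    | _ M ihM =>
      rcases lt_or_ge M (j + 2) with hM | hM
      · rw [hidx, hfac]
        calc M ^ (j + 1) = M * M ^ j := by ring
          _ ≤ (j + 1) * (j + 2) * (j.factorial * (j + 1).factorial *
              (spacedSets d (j + 1) (M + (j + 1) + d * (j + 1).choose 2)).card) := by
              gcongr
              · nlinarith
              · exact ihj M
          _ ≤ (j + 1) * (j + 2) * (j.factorial * (j + 1).factorial *
              (spacedSets d (j + 1 + 1)
                (M + (j + 1) + d * (j + 1).choose 2 + d * (j + 1) + 1)).card) := by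
              exact Nat.mul_le_mul_left _ (Nat.mul_le_mul_left _ (card_spacedSets_le_succ hd))
          _ = _ := by ring
      · obtain ⟨a, rfl⟩ := Nat.exists_eq_add_of_le' hM
        have ha := ihM a (by omega)
        have hj := ihj (a + (j + 2))
        have hrec := card_spacedSets_add_le (k := j + 1)
          (n := a + (j + 2) + (j + 1) + d * (j + 1).choose 2)
          (n' := a + (j + 1 + 1) + d * (j + 1 + 1).choose 2) hd (by rw [hidx a]; ring)
        rw [hidx (a + (j + 2))]
        rw [hfac] at ha ⊢
        calc (a + (j + 2)) ^ (j + 1)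
            ≤ (j + 1) * (j + 2) * (a + (j + 2)) ^ j + a ^ (j + 1) :=
              pow_succ_le_mul_pow_add_pow j a (j + 2)
          _ ≤ (j + 1) * (j + 2) * (j.factorial * (j + 1).factorial * _) + _ :=
              Nat.add_le_add (Nat.mul_le_mul_left _ hj) ha
          _ = (j + 1) * (j + 2) * (j.factorial * (j + 1).factorial) * (_ + _) := by
              ring
          _ ≤ _ := Nat.mul_le_mul_left _ hrec

lemma card_spacedSets_le_qpart {d k n : ℕ} : (spacedSets d k n).card ≤ qpart 1 d n := by
  rw [qpart, ← Nat.card_eq_finsetCard]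
  refine Nat.card_le_card_of_injective (fun s => ⟨⟨s.1.val, ?_, ?_⟩, ?_, ?_, ?_⟩) ?_
  · intro x hx
    exact (mem_spacedSets.1 s.2).1 x hx
  · exact (Finset.sum_val s.1).trans (mem_spacedSets.1 s.2).2.2.1
  · exact (mem_spacedSets.1 s.2).1
  · exact fun x _ => Multiset.nodup_iff_count_le_one.1 s.1.nodup x
  · intro x hx y hy hxy
    have h := (mem_spacedSets.1 s.2).2.2.2
    rcases lt_or_gt_of_ne hxy with hlt | hlt
    · have := h x hx y hy hlt
      rw [max_eq_right hlt.le, min_eq_left hlt.le]; omega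
    · have := h y hy x hx hlt
      rw [max_eq_left hlt.le, min_eq_right hlt.le]; omega
  · intro s t hst
    simp only [Subtype.mk.injEq, Nat.Partition.mk.injEq] at hst
    exact Subtype.ext (Finset.val_injective hst)

/-- The parts other than `1` available to partitions of `n` into parts from `QminusSet 1 m`. -/
noncomputable def largeParts (m n : ℕ) : Finset ℕ := by
  classical exact (Finset.Icc 2 n).filter (· ∈ QminusSet 1 m)

lemma exists_mul_eq_of_mem_largeParts {m n s : ℕ} (hm : 3 ≤ m) (hs : s ∈ largeParts m n) :
    1 ≤ (s + 1) / m ∧ (s = (s + 1) / m * m + 1 ∨ (2 ≤ (s + 1) / m ∧ s + 1 = (s + 1) / m * m)) := by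
  classical
  simp only [largeParts, Finset.mem_filter, Finset.mem_Icc, QminusSet, Set.mem_sdiff,
    Set.mem_ofPred_eq, Set.mem_singleton_iff] at hs
  obtain ⟨⟨h2, -⟩, hmod, hne⟩ := hs
  rw [Nat.mod_eq_of_lt (by omega : 1 < m), Nat.mod_eq_of_lt (by omega : m - 1 < m)] at hmod
  have hdiv := Nat.div_add_mod s m
  generalize s / m = c at hdiv
  rcases hmod with hmod | hmod
  · rw [hmod] at hdiv
    have hc : (s + 1) / m = c := by
      rw [← hdiv, add_assoc, Nat.mul_add_div (by omega), Nat.div_eq_of_lt (by omega), add_zero]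
    have hc0 : c ≠ 0 := by rintro h; rw [h] at hdiv; omega
    rw [hc]
    exact ⟨Nat.one_le_iff_ne_zero.2 hc0, Or.inl (by rw [mul_comm]; exact hdiv.symm)⟩
  · rw [hmod] at hdiv
    have hs1 : s + 1 = (c + 1) * m := by
      rw [add_mul, one_mul, mul_comm c]; omega
    have hc : (s + 1) / m = c + 1 := by rw [hs1, Nat.mul_div_cancel _ (by omega)]
    have hc0 : c ≠ 0 := by
      rintro h
      rw [h] at hdiv
      omega
    rw [hc]
    exact ⟨by omega, Or.inr ⟨by omega, hs1⟩⟩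

lemma weight_mul_le_of_mem_largeParts {m n s : ℕ} (hm : 3 ≤ m) (hs : s ∈ largeParts m n) :
    (s + 1) / m * (2 * m - 1) ≤ 2 * s := by
  obtain ⟨-, h | ⟨h2, h⟩⟩ := exists_mul_eq_of_mem_largeParts hm hs <;>
  · generalize (s + 1) / m = c at *
    rw [Nat.mul_sub, mul_one, mul_left_comm]
    omega

/-- The parts `c * m ± 1` all have weight `c`. -/
lemma sum_largeParts_le {m n : ℕ} (hm : 3 ≤ m) (g : ℕ → ℝ) (hg : ∀ c, 1 ≤ c → 0 ≤ g c) :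
    ∑ s ∈ largeParts m n, g ((s + 1) / m) ≤ 2 * ∑ c ∈ Finset.Icc 1 (n + 1), g c := by
  classical
  have hmaps : ∀ s ∈ largeParts m n, (s + 1) / m ∈ Finset.Icc 1 (n + 1) := by
    intro s hs
    have hle : s ≤ n := by
      simp only [largeParts, Finset.mem_filter, Finset.mem_Icc] at hs
      exact hs.1.2
    exact Finset.mem_Icc.2 ⟨(exists_mul_eq_of_mem_largeParts hm hs).1,
      (Nat.div_le_self _ _).trans (by omega)⟩
  rw [← Finset.sum_fiberwise_of_maps_to hmaps, Finset.mul_sum]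
  refine Finset.sum_le_sum fun c hc => ?_
  have hcard : ((largeParts m n).filter fun s => (s + 1) / m = c).card ≤ 2 := by
    refine (Finset.card_le_card (t := {c * m + 1, c * m - 1}) ?_).trans Finset.card_le_two
    intro s hs
    obtain ⟨hmem, rfl⟩ := Finset.mem_filter.1 hs
    rw [Finset.mem_insert, Finset.mem_singleton]
    obtain ⟨-, h | ⟨-, h⟩⟩ := exists_mul_eq_of_mem_largeParts hm hmem
    · exact Or.inl h
    · exact Or.inr (by rw [← h]; rfl)
  rw [Finset.sum_congr rfl (g := fun _ => g c) (fun s hs => by rw [(Finset.mem_filter.1 hs).2]),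
    Finset.sum_const, nsmul_eq_mul]
  have := hg c (Finset.mem_Icc.1 hc).1
  gcongr
  exact_mod_cast hcard

open Classical in
/-- Partitions into parts from `QminusSet 1 m` are determined by the multiplicities of the parts
other than `1`. -/
lemma rho_le_card {m n K : ℕ} (hm : 3 ≤ m) (hK : 2 * n < (K + 1) * (2 * m - 1)) :
    rho (QminusSet 1 m) n ≤
      ((Fintype.piFinset fun _ : largeParts m n => Finset.range (n + 1)).filter
        fun f => ∑ s, (s.1 + 1) / m * f s ≤ K).card := by
  rw [rho, ← Nat.card_eq_finsetCard]
  have hsum : ∀ p : n.Partition, ∑ s : largeParts m n, s.1 * p.parts.count s.1 ≤ n := by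
    intro p
    rw [Finset.sum_coe_sort (largeParts m n) (fun s => s * p.parts.count s)]
    calc ∑ s ∈ largeParts m n, s * p.parts.count s
        ≤ ∑ s ∈ largeParts m n ∪ p.parts.toFinset, s * p.parts.count s :=
          Finset.sum_le_sum_of_subset Finset.subset_union_left
      _ = p.parts.sum := by
          rw [Finset.sum_multiset_count_of_subset p.parts _ Finset.subset_union_right]
          exact Finset.sum_congr rfl fun s _ => by rw [smul_eq_mul, mul_comm]
      _ = n := p.parts_sum
  refine Nat.card_le_card_of_injective
    (fun p => ⟨fun s => p.1.parts.count s.1, Finset.mem_filter.2 ⟨?_, ?_⟩⟩) ?_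
  · rw [Fintype.mem_piFinset]
    intro s
    rw [Finset.mem_range, Nat.lt_succ_iff]
    have hs2 : 2 ≤ s.1 := by
      have := s.2
      simp only [largeParts, Finset.mem_filter, Finset.mem_Icc] at this
      exact this.1.1
    calc p.1.parts.count s.1 ≤ s.1 * p.1.parts.count s.1 := Nat.le_mul_of_pos_left _ (by omega)
      _ ≤ ∑ s : largeParts m n, s.1 * p.1.parts.count s.1 :=
          Finset.single_le_sum (f := fun s : largeParts m n => s.1 * p.1.parts.count s.1)
            (fun _ _ => Nat.zero_le _) (Finset.mem_univ s)
      _ ≤ n := hsum p.1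
  · have h : (∑ s : largeParts m n, (s.1 + 1) / m * p.1.parts.count s.1) * (2 * m - 1) ≤ 2 * n := by
      calc _ = ∑ s : largeParts m n, (s.1 + 1) / m * (2 * m - 1) * p.1.parts.count s.1 := by
            rw [Finset.sum_mul]
            exact Finset.sum_congr rfl fun s _ => by ring
        _ ≤ ∑ s : largeParts m n, 2 * s.1 * p.1.parts.count s.1 :=
            Finset.sum_le_sum fun s _ =>
              Nat.mul_le_mul_right _ (weight_mul_le_of_mem_largeParts hm s.2)
        _ = 2 * ∑ s : largeParts m n, s.1 * p.1.parts.count s.1 := by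
            rw [Finset.mul_sum]
            exact Finset.sum_congr rfl fun s _ => by ring
        _ ≤ 2 * n := by have := hsum p.1; omega
    exact Nat.lt_succ_iff.1 (lt_of_mul_lt_mul_right (h.trans_lt hK) (Nat.zero_le _))
  · intro p p' hpp'
    have hcount : ∀ s ∈ largeParts m n, p.1.parts.count s = p'.1.parts.count s := fun s hs =>
      congrFun (Subtype.ext_iff.1 hpp') ⟨s, hs⟩
    have hne : ∀ x, x ≠ 1 → p.1.parts.count x = p'.1.parts.count x := by
      intro x hx
      by_cases hmem : x ∈ largeParts m n
      · exact hcount x hmem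
      · have hnot : ∀ r : {r : n.Partition // ∀ x ∈ r.parts, x ∈ QminusSet 1 m},
            x ∉ r.1.parts := by
          intro r hxr
          apply hmem
          have := r.1.parts_pos hxr
          have := r.1.le_of_mem_parts hxr
          exact Finset.mem_filter.2 ⟨Finset.mem_Icc.2 (by omega), r.2 x hxr⟩
        rw [Multiset.count_eq_zero_of_notMem (hnot p), Multiset.count_eq_zero_of_notMem (hnot p')]
    have hone : p.1.parts.count 1 = p'.1.parts.count 1 := by
      have hsplit : ∀ r : n.Partition, r.parts.count 1 +
          ∑ x ∈ (insert 1 (p.1.parts.toFinset ∪ p'.1.parts.toFinset)).erase 1,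
            r.parts.count x * x = ∑ x ∈ insert 1 (p.1.parts.toFinset ∪ p'.1.parts.toFinset),
            r.parts.count x * x := by
        intro r
        rw [← Finset.add_sum_erase _ _ (Finset.mem_insert_self _ _), mul_one]
      have htot : ∀ r : n.Partition,
          r.parts.toFinset ⊆ insert 1 (p.1.parts.toFinset ∪ p'.1.parts.toFinset) →
          ∑ x ∈ insert 1 (p.1.parts.toFinset ∪ p'.1.parts.toFinset), r.parts.count x * x = n := by
        intro r hr
        conv_rhs => rw [← r.parts_sum, Finset.sum_multiset_count_of_subset r.parts _ hr]
        rfl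
      have h1 := hsplit p.1
      have h2 := hsplit p'.1
      rw [htot _ (Finset.subset_union_left.trans (Finset.subset_insert _ _))] at h1
      rw [htot _ (Finset.subset_union_right.trans (Finset.subset_insert _ _))] at h2
      have h3 := Finset.sum_congr (f := fun x => p.1.parts.count x * x)
        (g := fun x => p'.1.parts.count x * x)
        (Eq.refl ((insert 1 (p.1.parts.toFinset ∪ p'.1.parts.toFinset)).erase 1))
        (fun x hx => by simp only [hne x (Finset.ne_of_mem_erase hx)])
      omega
    refine Subtype.ext (Nat.Partition.ext (Multiset.ext.2 fun x => ?_))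
    rcases eq_or_ne x 1 with rfl | hx
    · exact hone
    · exact hne x hx

lemma geom_sum_le_exp_neg_log {z : ℝ} (hz0 : 0 ≤ z) (hz1 : z < 1) (n : ℕ) :
    ∑ i ∈ Finset.range n, z ^ i ≤ Real.exp (-Real.log (1 - z)) := by
  rw [Real.exp_neg, Real.exp_log (by linarith), ← tsum_geometric_of_lt_one hz0 hz1]
  exact (summable_geometric_of_lt_one hz0 hz1).sum_le_tsum _ (fun i _ => by positivity)

lemma rho_le_pow_mul_exp {m n K : ℕ} (hm : 3 ≤ m) (hK : 2 * n < (K + 1) * (2 * m - 1)) {y : ℝ}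
    (hy0 : 0 < y) (hy1 : y < 1) :
    (rho (QminusSet 1 m) n : ℝ) ≤
      y⁻¹ ^ K * Real.exp (2 * (Real.pi ^ 2 / 6 * (y / (1 - y)))) := by
  classical
  have hy : ∀ c, 1 ≤ c → y ^ c < 1 := fun c hc => pow_lt_one₀ hy0.le hy1 (by omega)
  set F := Fintype.piFinset fun _ : largeParts m n => Finset.range (n + 1)
  have hprod : ∑ f ∈ F, y ^ ∑ s, (s.1 + 1) / m * f s ≤
      Real.exp (2 * (Real.pi ^ 2 / 6 * (y / (1 - y)))) := by
    calc ∑ f ∈ F, y ^ ∑ s, (s.1 + 1) / m * f s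
        = ∑ f ∈ F, ∏ s, (y ^ ((s.1 + 1) / m)) ^ f s := by
          refine Finset.sum_congr rfl fun f _ => ?_
          rw [← Finset.prod_pow_eq_pow_sum]
          exact Finset.prod_congr rfl fun s _ => pow_mul _ _ _
      _ = ∏ s : largeParts m n, ∑ i ∈ Finset.range (n + 1), (y ^ ((s.1 + 1) / m)) ^ i :=
          (Finset.prod_univ_sum _ _).symm
      _ ≤ ∏ s : largeParts m n, Real.exp (-Real.log (1 - y ^ ((s.1 + 1) / m))) :=
          Finset.prod_le_prod (fun _ _ => by positivity) fun s _ =>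
            geom_sum_le_exp_neg_log (by positivity)
              (hy _ (exists_mul_eq_of_mem_largeParts hm s.2).1) _
      _ = Real.exp (∑ s ∈ largeParts m n, -Real.log (1 - y ^ ((s + 1) / m))) := by
          rw [← Real.exp_sum,
            Finset.sum_coe_sort (largeParts m n) (fun s => -Real.log (1 - y ^ ((s + 1) / m)))]
      _ ≤ Real.exp (2 * ∑ c ∈ Finset.Icc 1 (n + 1), -Real.log (1 - y ^ c)) := by
          refine Real.exp_le_exp.2 (sum_largeParts_le hm (fun c => -Real.log (1 - y ^ c)) ?_)
          intro c hc
          have := Real.log_nonpos (x := 1 - y ^ c) (by linarith [hy c hc])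
            (by linarith [pow_pos hy0 c])
          linarith
      _ ≤ _ := by
          refine Real.exp_le_exp.2 ?_
          linarith [sum_neg_log_one_sub_pow_le hy0 hy1 (n + 1)]
  calc (rho (QminusSet 1 m) n : ℝ)
      ≤ ((F.filter fun f => ∑ s, (s.1 + 1) / m * f s ≤ K).card : ℝ) := by
        exact_mod_cast rho_le_card hm hK
    _ = ∑ f ∈ F.filter fun f => ∑ s, (s.1 + 1) / m * f s ≤ K, (1 : ℝ) := by simp
    _ ≤ ∑ f ∈ F.filter fun f => ∑ s, (s.1 + 1) / m * f s ≤ K,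
          y⁻¹ ^ K * y ^ ∑ s, (s.1 + 1) / m * f s := by
        refine Finset.sum_le_sum fun f hf => ?_
        rw [inv_pow, ← div_eq_inv_mul, le_div_iff₀ (by positivity), one_mul]
        exact pow_le_pow_of_le_one hy0.le hy1.le (Finset.mem_filter.1 hf).2
    _ ≤ ∑ f ∈ F, y⁻¹ ^ K * y ^ ∑ s, (s.1 + 1) / m * f s :=
        Finset.sum_le_sum_of_subset_of_nonneg (Finset.filter_subset _ _)
          fun _ _ _ => by positivity
    _ = y⁻¹ ^ K * ∑ f ∈ F, y ^ ∑ s, (s.1 + 1) / m * f s := by rw [Finset.mul_sum]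
    _ ≤ _ := by gcongr

lemma rho_le_mul_pow {m n K v : ℕ} (hm : 3 ≤ m) (hK : 2 * n < (K + 1) * (2 * m - 1))
    (hv : 1 ≤ v) :
    (rho (QminusSet 1 m) n : ℝ) ≤ (26 / 5) ^ v * (1 + 2 / (v : ℝ)) ^ K := by
  have hv0 : (0 : ℝ) < v := by exact_mod_cast hv
  have h := rho_le_pow_mul_exp hm hK (y := (v : ℝ) / (v + 2)) (by positivity)
    (by rw [div_lt_one (by positivity)]; linarith)
  have h1 : ((v : ℝ) / (v + 2))⁻¹ = 1 + 2 / (v : ℝ) := by rw [inv_div]; field_simp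
  have h2 : 2 * (Real.pi ^ 2 / 6 * ((v : ℝ) / (v + 2) / (1 - (v : ℝ) / (v + 2)))) =
      v * (Real.pi ^ 2 / 6) := by
    have : 1 - (v : ℝ) / (v + 2) = 2 / (v + 2) := by field_simp; ring
    rw [this]
    field_simp
  rw [h1, h2, Real.exp_nat_mul, mul_comm] at h
  refine h.trans ?_
  gcongr
  exact exp_pi_sq_div_six_le

/-- If `(1 + 2 / v) ^ K` is small against the number of `(j + 1)`-part partitions with differences
at least `d`, the desired inequality follows. -/
lemma Qminus_le_qpart_of_le {d e n K j v B M : ℕ} (hd : 1 ≤ d)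
    (hK : 2 * n < (K + 1) * (2 * (e + 3) - 1)) (hv : 1 ≤ v) (hKB : K ≤ B)
    (hM : M + (j + 1) + d * (j + 1).choose 2 ≤ n)
    (h : (26 / 5 : ℝ) ^ v * (1 + 2 / (v : ℝ)) ^ B * (j.factorial * (j + 1).factorial) ≤ M ^ j) :
    Qminus 1 e n ≤ qpart 1 d n := by
  obtain ⟨M', hM'⟩ := Nat.exists_eq_add_of_le' hM
  have hlow := pow_le_factorial_mul_card_spacedSets hd j (M + M')
  have hn : M + M' + (j + 1) + d * (j + 1).choose 2 = n := by omega
  rw [hn] at hlow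
  have hlow' : (M : ℝ) ^ j ≤ j.factorial * (j + 1).factorial * qpart 1 d n := by
    have : M ^ j ≤ j.factorial * (j + 1).factorial * qpart 1 d n :=
      (Nat.pow_le_pow_left (Nat.le_add_right _ _) _).trans
        (hlow.trans (Nat.mul_le_mul_left _ card_spacedSets_le_qpart))
    exact_mod_cast this
  have hup := rho_le_mul_pow (m := e + 3) (by omega) hK hv
  have hB : (1 + 2 / (v : ℝ)) ^ K ≤ (1 + 2 / (v : ℝ)) ^ B :=
    pow_le_pow_right₀ (le_add_of_nonneg_right (by positivity)) hKB
  have hfac : (0 : ℝ) < j.factorial * (j + 1).factorial := by positivity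
  have : (Qminus 1 e n : ℝ) ≤ qpart 1 d n := by
    refine le_of_mul_le_mul_left ?_ hfac
    calc (j.factorial * (j + 1).factorial : ℝ) * Qminus 1 e n
        ≤ j.factorial * (j + 1).factorial * ((26 / 5) ^ v * (1 + 2 / (v : ℝ)) ^ B) := by
          gcongr
          exact hup.trans (by gcongr)
      _ ≤ M ^ j := by rw [mul_comm]; exact h
      _ ≤ _ := hlow'
  exact_mod_cast this

lemma exists_triangular_window {K : ℕ} (hK : 42 ≤ K) :
    ∃ j, 7 ≤ j ∧ 3 * (j * (j + 1)) ≤ 4 * K ∧ 4 * K ≤ 3 * ((j + 1) * (j + 2)) := by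
  induction K, hK using Nat.le_induction with
  | base => exact ⟨7, by norm_num⟩
  | succ K hK ih =>
    obtain ⟨j, h7, h1, h2⟩ := ih
    by_cases h : 4 * (K + 1) ≤ 3 * ((j + 1) * (j + 2))
    · exact ⟨j, h7, by omega, h⟩
    · refine ⟨j + 1, by omega, ?_, ?_⟩
      · have : (j + 1) * (j + 1 + 1) = (j + 1) * (j + 2) := rfl
        omega
      · nlinarith

lemma large_window_bound {K j : ℕ} (hj : 7 ≤ j) (hK : 4 * K ≤ 3 * ((j + 1) * (j + 2))) :
    (26 / 5 : ℝ) ^ (j + 1) * (1 + 2 / ((j + 1 : ℕ) : ℝ)) ^ K *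
      (j.factorial * (j + 1).factorial) ≤ ((14 * (j * (j + 1)) : ℕ) : ℝ) ^ j := by
  have hexp : (1 + 2 / ((j + 1 : ℕ) : ℝ)) ^ K ≤ (9 / 2) ^ (j + 2) := by
    have hj0 : (0 : ℝ) < ((j + 1 : ℕ) : ℝ) := by positivity
    calc (1 + 2 / ((j + 1 : ℕ) : ℝ)) ^ K ≤ Real.exp (2 / ((j + 1 : ℕ) : ℝ)) ^ K := by
          gcongr
          linarith [Real.add_one_le_exp (2 / ((j + 1 : ℕ) : ℝ))]
      _ = Real.exp (K * (2 / ((j + 1 : ℕ) : ℝ))) := (Real.exp_nat_mul _ _).symm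
      _ ≤ Real.exp ((j + 2 : ℕ) * (3 / 2)) := by
          refine Real.exp_le_exp.2 ?_
          have hK' : 4 * (K : ℝ) ≤ 3 * (((j + 1 : ℕ) : ℝ) * ((j + 2 : ℕ) : ℝ)) := by
            exact_mod_cast hK
          rw [← mul_div_assoc, div_le_iff₀ hj0]
          linarith
      _ = Real.exp (3 / 2) ^ (j + 2) := Real.exp_nat_mul _ _
      _ ≤ _ := by gcongr; exact exp_three_halves_le
  refine le_trans ?_ ((factorial_mul_pow_le hj).trans (le_of_eq (by push_cast; ring)))
  gcongr

theorem stmt8 (N d n : ℕ) (hN : 2 ≤ N) (hd : max 63 (46 * N - 79) ≤ d)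
    (hn : 7 * d + 14 ≤ n) :
    Qminus 1 (d - N) n ≤ qpart 1 d n := by
  have hd63 : 63 ≤ d := le_trans (le_max_left _ _) hd
  have hdN : 46 * N ≤ d + 79 := by
    have := le_trans (le_max_right _ _) hd
    omega
  obtain ⟨m, hm⟩ : ∃ m, m = d - N + 3 := ⟨_, rfl⟩
  obtain ⟨K, hKdef⟩ : ∃ K, K = 2 * n / (2 * m - 1) := ⟨_, rfl⟩
  have hlt : 2 * n < (K + 1) * (2 * (d - N + 3) - 1) := by
    rw [← hm, hKdef, mul_comm (_ + 1)]
    exact Nat.lt_mul_div_succ (2 * n) (by omega : 0 < 2 * m - 1)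
  have hle : K * (2 * m - 1) ≤ 2 * n := by
    rw [hKdef]
    exact Nat.div_mul_le_self _ _
  have hK7 : 7 ≤ K := by
    rw [hKdef, Nat.le_div_iff_mul_le (by omega)]
    omega
  have hKn : 45 * (K * d) + 36 * K ≤ 46 * n := by
    have h1 : K * (90 * d + 72) ≤ K * (46 * (2 * m - 1)) := Nat.mul_le_mul_left _ (by omega)
    have h2 : K * (46 * (2 * m - 1)) = 46 * (K * (2 * m - 1)) := by ring
    have h3 : K * (90 * d + 72) = 90 * (K * d) + 72 * K := by ring
    omega
  have hd1 : 1 ≤ d := by omega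
  have hwin : ∀ a, a ≤ K → 45 * (a * d) + 36 * a ≤ 46 * n := by
    intro a ha
    have := Nat.mul_le_mul_right d ha
    omega
  rcases le_or_gt 42 K with hK | hK
  · obtain ⟨j, hj, hj1, hj2⟩ := exists_triangular_window hK
    refine Qminus_le_qpart_of_le (M := 14 * (j * (j + 1))) hd1 hlt (by omega : 1 ≤ j + 1) le_rfl ?_
      (large_window_bound hj hj2)
    have hch : (j + 1).choose 2 * 2 = j * (j + 1) := by
      rw [Nat.choose_two_right, Nat.add_sub_cancel,
        Nat.div_mul_cancel (by rw [mul_comm]; exact (Nat.even_mul_succ_self j).two_dvd), mul_comm]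
    generalize (j + 1).choose 2 = t at hch ⊢
    rw [← hch] at hj1 ⊢
    have hjt : 7 * (j + 1) ≤ 2 * t := by nlinarith
    nlinarith [Nat.mul_le_mul_right d hj1, Nat.mul_le_mul_left t hd63]
  · rcases le_or_gt K 7 with h7 | h7
    · exact Qminus_le_qpart_of_le (B := 7) (j := 2) (v := 2) (M := 243) hd1 hlt (by norm_num) h7
        (by have := hwin 7 (by omega); norm_num [Nat.choose]; omega) (by norm_num [Nat.factorial])
    rcases le_or_gt K 8 with h8 | h8
    · exact Qminus_le_qpart_of_le (B := 8) (j := 2) (v := 2) (M := 306) hd1 hlt (by norm_num) h8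
        (by have := hwin 8 (by omega); norm_num [Nat.choose]; omega) (by norm_num [Nat.factorial])
    rcases le_or_gt K 11 with h11 | h11
    · exact Qminus_le_qpart_of_le (B := 11) (j := 3) (v := 3) (M := 178) hd1 hlt (by norm_num) h11
        (by have := hwin 9 (by omega); norm_num [Nat.choose]; omega) (by norm_num [Nat.factorial])
    rcases le_or_gt K 15 with h15 | h15
    · exact Qminus_le_qpart_of_le (B := 15) (j := 3) (v := 3) (M := 365) hd1 hlt (by norm_num) h15
        (by have := hwin 12 (by omega); norm_num [Nat.choose]; omega) (by norm_num [Nat.factorial])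
    rcases le_or_gt K 22 with h22 | h22
    · exact Qminus_le_qpart_of_le (B := 22) (j := 4) (v := 4) (M := 362) hd1 hlt (by norm_num) h22
        (by have := hwin 16 (by omega); norm_num [Nat.choose]; omega) (by norm_num [Nat.factorial])
    rcases le_or_gt K 33 with h33 | h33
    · exact Qminus_le_qpart_of_le (B := 33) (j := 5) (v := 5) (M := 483) hd1 hlt (by norm_num) h33
        (by have := hwin 23 (by omega); norm_num [Nat.choose]; omega) (by norm_num [Nat.factorial])
    · exact Qminus_le_qpart_of_le (B := 42) (j := 6) (v := 7) (M := 791) hd1 hlt (by norm_num)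
        hK.le (by have := hwin 34 (by omega); norm_num [Nat.choose]; omega)
        (by norm_num [Nat.factorial])
end

section
/- Let d ≥ 63 and n ≥ 5d. Then q_d^{(1)}(n) ≥ ρ(T_{5,d}; n), where ρ(T_{5,d}; n) is the number of partitions of n into parts congruent to 1, d+2, d+4, d+8, or d+16 modulo 2d. -/
open PowerSeries Finset

/-- A power series with nonnegative coefficients. -/
def CoeffNonneg (f : ℤ⟦X⟧) : Prop := ∀ n, 0 ≤ coeff n f

namespace CoeffNonneg

lemma zero : CoeffNonneg 0 := fun n => by simp

lemma X_pow (m : ℕ) : CoeffNonneg (X ^ m) := fun n => by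
  rw [coeff_X_pow]; split_ifs <;> simp

lemma one : CoeffNonneg 1 := by simpa using X_pow 0

lemma add {f g : ℤ⟦X⟧} (hf : CoeffNonneg f) (hg : CoeffNonneg g) : CoeffNonneg (f + g) :=
  fun n => by rw [map_add]; exact add_nonneg (hf n) (hg n)

lemma mul {f g : ℤ⟦X⟧} (hf : CoeffNonneg f) (hg : CoeffNonneg g) : CoeffNonneg (f * g) :=
  fun n => by rw [coeff_mul]; exact Finset.sum_nonneg fun p _ => mul_nonneg (hf _) (hg _)

lemma sum {ι : Type*} (s : Finset ι) {f : ι → ℤ⟦X⟧} (h : ∀ i ∈ s, CoeffNonneg (f i)) :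
    CoeffNonneg (∑ i ∈ s, f i) :=
  fun n => by rw [map_sum]; exact Finset.sum_nonneg fun i hi => h i hi n

lemma prod {ι : Type*} (s : Finset ι) {f : ι → ℤ⟦X⟧} (h : ∀ i ∈ s, CoeffNonneg (f i)) :
    CoeffNonneg (∏ i ∈ s, f i) :=
  Finset.prod_induction f CoeffNonneg (fun _ _ => mul) one h

end CoeffNonneg

/-- The expansion of `1 / (1 - X ^ m)`. -/
noncomputable def geomSeries (m : ℕ) : ℤ⟦X⟧ := PowerSeries.mk fun n => if m ∣ n then 1 else 0

lemma CoeffNonneg.geomSeries (m : ℕ) : CoeffNonneg (geomSeries m) := fun n => by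
  rw [_root_.geomSeries, coeff_mk]; split_ifs <;> simp

lemma one_sub_X_pow_mul_geomSeries {m : ℕ} (hm : 0 < m) :
    (1 - X ^ m) * geomSeries m = 1 := by
  ext n
  rw [sub_mul, one_mul, map_sub, coeff_X_pow_mul', geomSeries, coeff_mk, coeff_one]
  by_cases h : m ≤ n
  · rw [if_pos h, coeff_mk, if_neg (by omega : n ≠ 0)]
    simp [Nat.dvd_sub_iff_left h dvd_rfl]
  · rw [if_neg h]
    rcases Nat.eq_zero_or_pos n with rfl | hn
    · simp
    · rw [if_neg fun hd => h (Nat.le_of_dvd hn hd), if_neg hn.ne', sub_zero]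

/-- The generating function of partitions into `s` parts, all at least `0` and
pairwise differing by at least `d`. -/
noncomputable def gapKernel (d : ℕ) : ℕ → ℤ⟦X⟧
  | 0 => 1
  | s + 1 => X ^ (d * s) * gapKernel d s * geomSeries (s + 1)

/-- The generating function of partitions into `s` parts, all at least `b` and
pairwise differing by at least `d`. -/
noncomputable def gapSeries (d s b : ℕ) : ℤ⟦X⟧ := X ^ (b * s) * gapKernel d s

lemma CoeffNonneg.gapKernel (d s : ℕ) : CoeffNonneg (gapKernel d s) := by
  induction s with
  | zero => exact one
  | succ s ih => exact ((X_pow _).mul ih).mul (geomSeries _)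

lemma CoeffNonneg.gapSeries (d s b : ℕ) : CoeffNonneg (gapSeries d s b) :=
  (X_pow _).mul (gapKernel d s)

lemma gapSeries_zero (d b : ℕ) : gapSeries d 0 b = 1 := by simp [gapSeries, gapKernel]

lemma gapSeries_add (d s b m : ℕ) : gapSeries d s (b + m) = X ^ (m * s) * gapSeries d s b := by
  rw [gapSeries, gapSeries]; ring

lemma gapSeries_succ_sub (d s b : ℕ) :
    gapSeries d (s + 1) b - gapSeries d (s + 1) (b + 1) = X ^ b * gapSeries d s (b + d) := by
  have h := one_sub_X_pow_mul_geomSeries (m := s + 1) (by omega)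
  simp only [gapSeries, gapKernel]
  linear_combination (X ^ (b * (s + 1) + d * s) * gapKernel d s) * h

lemma gapSeries_succ_sub_eq_sum (d s b m : ℕ) :
    gapSeries d (s + 1) b - gapSeries d (s + 1) (b + m) =
      ∑ i ∈ range m, X ^ (b + i) * gapSeries d s (b + i + d) := by
  induction m with
  | zero => simp
  | succ m ih =>
    rw [sum_range_succ, ← ih, ← gapSeries_succ_sub]
    ring_nf

/-- `gapSeries` is antitone in the lower bound on the parts. -/
lemma gapSeries_antitone (d s b m : ℕ) :
    CoeffNonneg (gapSeries d s b - gapSeries d s (b + m)) := by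
  cases s with
  | zero => simpa [gapSeries_zero] using CoeffNonneg.zero
  | succ s =>
    rw [gapSeries_succ_sub_eq_sum]
    exact CoeffNonneg.sum _ fun i _ => (CoeffNonneg.X_pow _).mul (CoeffNonneg.gapSeries _ _ _)

/-- Translating by `a ≤ d` the smallest part of a partition whose smallest part lies in
`[b, b + m)`, and all the other parts by `d`. -/
lemma gapSeries_translate (d s a b m : ℕ) (ha : a ≤ d) :
    CoeffNonneg (gapSeries d (s + 1) (a + b) - gapSeries d (s + 1) (a + b + m) -
      X ^ a * X ^ (d * s) * (gapSeries d (s + 1) b - gapSeries d (s + 1) (b + m))) := by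
  rw [gapSeries_succ_sub_eq_sum, gapSeries_succ_sub_eq_sum, mul_sum, ← sum_sub_distrib]
  refine CoeffNonneg.sum _ fun i _ => ?_
  obtain ⟨e, rfl⟩ := Nat.exists_eq_add_of_le ha
  have key := (CoeffNonneg.X_pow (a + b + i)).mul
    (gapSeries_antitone (a + e) s (a + b + i + (a + e)) e)
  convert key using 1
  rw [show a + b + i + (a + e) + e = b + i + (a + e) + (a + e) by ring,
    gapSeries_add _ _ (b + i + (a + e))]
  ring

/-- The part of the generating function of the refined partitions with `s + 1` parts in which the
smallest part is less than `2 ^ j`. Here `Φ` and `Ψ` are the data for `s` parts. -/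
noncomputable def refinedLow (d s : ℕ) (Φ : ℤ⟦X⟧) (Ψ : ℕ → ℤ⟦X⟧) : ℕ → ℤ⟦X⟧
  | 0 => 0
  | j + 1 => refinedLow d s Φ Ψ j +
      X ^ 2 ^ j * X ^ (d * s) * (refinedLow d s Φ Ψ j + (Φ - Ψ j))

/-- Generating function of the residues which are available to the largest part only. -/
noncomputable def topResidues (d : ℕ) : ℤ⟦X⟧ := ∑ i ∈ Ico 64 (d + 1), X ^ i

/-- Generating functions of a class of partitions into `s` parts pairwise differing by at least
`d`: the parts other than the largest are congruent to one of `1, …, 63` modulo `d`, and a part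
whose residue has `w` binary digits `1`, the lowest being `v`, is exceeded by the next larger part
by at least `d * w + v` minus the residue. The first component counts all of them, the second
those in which the smallest part is less than `2 ^ j`. -/
noncomputable def refinedPair (d : ℕ) : ℕ → ℤ⟦X⟧ × (ℕ → ℤ⟦X⟧)
  | 0 => (1, 0)
  | s + 1 =>
    ((refinedLow d s (refinedPair d s).1 (refinedPair d s).2 6 +
        if s = 0 then topResidues d else 0) * geomSeries (d * (s + 1)),
      refinedLow d s (refinedPair d s).1 (refinedPair d s).2)

/-- All refined partitions with `s` parts. -/
noncomputable def refinedAll (d s : ℕ) : ℤ⟦X⟧ := (refinedPair d s).1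

/-- The refined partitions with `s` parts, the smallest being less than `2 ^ j`. -/
noncomputable def refinedBelow (d s j : ℕ) : ℤ⟦X⟧ := (refinedPair d s).2 j

lemma refinedAll_zero (d : ℕ) : refinedAll d 0 = 1 := rfl

lemma refinedBelow_zero_left (d j : ℕ) : refinedBelow d 0 j = 0 := rfl

lemma refinedBelow_zero_right (d s : ℕ) : refinedBelow d s 0 = 0 := by
  cases s <;> rfl

lemma refinedBelow_succ_succ (d s j : ℕ) :
    refinedBelow d (s + 1) (j + 1) = refinedBelow d (s + 1) j +
      X ^ 2 ^ j * X ^ (d * s) *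
        (refinedBelow d (s + 1) j + (refinedAll d s - refinedBelow d s j)) := rfl

lemma refinedAll_succ (d s : ℕ) :
    refinedAll d (s + 1) =
      (refinedBelow d (s + 1) 6 + if s = 0 then topResidues d else 0) *
        geomSeries (d * (s + 1)) := rfl

lemma refinedBelow_six {d : ℕ} (hd : 0 < d) (s : ℕ) :
    refinedBelow d s 6 =
      (1 - X ^ (d * s)) * refinedAll d s - if s = 1 then topResidues d else 0 := by
  cases s with
  | zero => simp [refinedBelow_zero_left]
  | succ s =>
    rw [refinedAll_succ]
    have h := one_sub_X_pow_mul_geomSeries (m := d * (s + 1)) (by positivity)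
    simp only [Nat.add_eq_right]
    linear_combination
      (-(refinedBelow d (s + 1) 6 + if s = 0 then topResidues d else 0)) * h

/-- A refined partition is a partition into parts pairwise differing by at least `d`. -/
lemma refined_le_gapSeries {d : ℕ} (hd : 63 ≤ d) (s : ℕ) :
    CoeffNonneg (gapSeries d s 1 - refinedAll d s) ∧
      ∀ j ≤ 6, CoeffNonneg (gapSeries d s (2 ^ j) - (refinedAll d s - refinedBelow d s j)) := by
  induction s with
  | zero =>
    simp only [gapSeries_zero, refinedAll_zero, refinedBelow_zero_left, sub_zero, sub_self]
    exact ⟨CoeffNonneg.zero, fun _ _ => CoeffNonneg.zero⟩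
  | succ s ih =>
    have low : ∀ j ≤ 6,
        CoeffNonneg (gapSeries d (s + 1) 1 - gapSeries d (s + 1) (2 ^ j)
          - refinedBelow d (s + 1) j) ∧
        ∀ i ≤ j, CoeffNonneg (gapSeries d (s + 1) (2 ^ i) - gapSeries d (s + 1) (2 ^ j)
          - (refinedBelow d (s + 1) j - refinedBelow d (s + 1) i)) := by
      intro j
      induction j with
      | zero =>
        intro _
        simp only [pow_zero, sub_self, refinedBelow_zero_right, nonpos_iff_eq_zero]
        refine ⟨CoeffNonneg.zero, ?_⟩
        rintro i rfl
        simpa [refinedBelow_zero_right] using CoeffNonneg.zero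
      | succ j ihj =>
        intro hj
        obtain ⟨h₁, h₂⟩ := ihj (by omega)
        have hjd : 2 ^ j ≤ d := (Nat.pow_le_pow_right two_pos (by omega : j ≤ 5)).trans (by omega)
        have step : CoeffNonneg (gapSeries d (s + 1) (2 ^ j) - gapSeries d (s + 1) (2 ^ (j + 1))
            - (refinedBelow d (s + 1) (j + 1) - refinedBelow d (s + 1) j)) := by
          have k₁ := gapSeries_translate d s (2 ^ j) 1 (2 ^ j - 1) hjd
          rw [show 2 ^ j + 1 + (2 ^ j - 1) = 2 ^ (j + 1) by
            have := Nat.one_le_two_pow (n := j); rw [pow_succ]; omega,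
            show 1 + (2 ^ j - 1) = 2 ^ j by have := Nat.one_le_two_pow (n := j); omega] at k₁
          have hX := (CoeffNonneg.X_pow (2 ^ j)).mul (CoeffNonneg.X_pow (d * s))
          convert (k₁.add (hX.mul h₁)).add (hX.mul (ih.2 j (by omega))) using 1
          rw [refinedBelow_succ_succ]
          have e := gapSeries_succ_sub d s (2 ^ j)
          rw [gapSeries_add d s] at e
          linear_combination e
        constructor
        · convert h₁.add step using 1
          ring
        · intro i hi
          rcases Nat.lt_or_eq_of_le hi with hi | rfl
          · convert (h₂ i (by omega)).add step using 1
            ring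
          · simpa using CoeffNonneg.zero
    have top : CoeffNonneg (gapSeries d (s + 1) 64 - gapSeries d (s + 1) (1 + d)
        - if s = 0 then topResidues d else 0) := by
      rw [show 1 + d = 64 + (d - 63) by omega]
      split_ifs with h
      · subst h
        rw [gapSeries_succ_sub_eq_sum, topResidues, sum_Ico_eq_sum_range,
          show d + 1 - 64 = d - 63 by omega]
        simpa [gapSeries_zero] using CoeffNonneg.zero
      · simpa using gapSeries_antitone d (s + 1) 64 (d - 63)
    have hgeom := one_sub_X_pow_mul_geomSeries (m := d * (s + 1)) (by positivity)
    have all : CoeffNonneg (gapSeries d (s + 1) 1 - refinedAll d (s + 1)) := by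
      convert ((low 6 le_rfl).1.add top).mul (CoeffNonneg.geomSeries (d * (s + 1))) using 1
      rw [refinedAll_succ, gapSeries_add]
      norm_num only
      linear_combination (-gapSeries d (s + 1) 1) * hgeom
    refine ⟨all, fun j hj => ?_⟩
    convert (((low 6 le_rfl).2 j hj).add top).add
      ((CoeffNonneg.X_pow (d * (s + 1))).mul all) using 1
    rw [refinedBelow_six (by omega), gapSeries_add]
    simp only [Nat.add_eq_right]
    norm_num only
    ring

/-- The expansion of `1 / ((1 - X ^ d) ⋯ (1 - X ^ (d * m)))`. -/
noncomputable def invPochhammer (d m : ℕ) : ℤ⟦X⟧ := ∏ i ∈ range m, geomSeries (d * (i + 1))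

lemma one_sub_mul_invPochhammer_succ {d : ℕ} (hd : 0 < d) (m : ℕ) :
    (1 - X ^ (d * (m + 1))) * invPochhammer d (m + 1) = invPochhammer d m := by
  rw [invPochhammer, prod_range_succ, ← invPochhammer]
  linear_combination invPochhammer d m *
    one_sub_X_pow_mul_geomSeries (m := d * (m + 1)) (by positivity)

lemma pochhammer_mul_invPochhammer {d : ℕ} (hd : 0 < d) (m : ℕ) :
    (∏ i ∈ range m, (1 - X ^ (d * (i + 1)))) * invPochhammer d m = 1 := by
  rw [invPochhammer, ← prod_mul_distrib]
  exact prod_eq_one fun i _ => one_sub_X_pow_mul_geomSeries (by positivity)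

/-- Summation by parts against `invPochhammer`. -/
lemma sum_antidiagonal_sub_mul_invPochhammer {d : ℕ} (hd : 0 < d) (D : ℕ → ℤ⟦X⟧) (n : ℕ) :
    ∑ p ∈ antidiagonal n, (D (p.1 + 1) - D p.1) * invPochhammer d p.2 + D 0 * invPochhammer d n =
      ∑ p ∈ antidiagonal n, D (p.1 + 1) * (X ^ (d * p.2) * invPochhammer d p.2) := by
  cases n with
  | zero => simp; ring
  | succ n =>
    have h : ∑ p ∈ antidiagonal (n + 1),
        D (p.1 + 1) * ((1 - X ^ (d * p.2)) * invPochhammer d p.2) =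
          ∑ p ∈ antidiagonal n, D (p.1 + 1) * invPochhammer d p.2 := by
      rw [Finset.Nat.sum_antidiagonal_succ']
      simp [one_sub_mul_invPochhammer_succ hd]
    have h' : ∑ p ∈ antidiagonal (n + 1), D p.1 * invPochhammer d p.2 =
        D 0 * invPochhammer d (n + 1) +
          ∑ p ∈ antidiagonal n, D (p.1 + 1) * invPochhammer d p.2 :=
      Finset.Nat.sum_antidiagonal_succ
    simp only [sub_mul, one_mul, mul_sub, sum_sub_distrib] at h ⊢
    linear_combination h - h'

/-- The Cauchy product of `refinedAll d` and `invPochhammer d`. -/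
noncomputable def refinedConv (d n : ℕ) : ℤ⟦X⟧ :=
  ∑ p ∈ antidiagonal n, refinedAll d p.1 * invPochhammer d p.2

/-- Interpolates between `refinedConv d n` at `j = 0` and `refinedConv d (n + 1)` at `j = 6`. -/
noncomputable def refinedConvBelow (d n j : ℕ) : ℤ⟦X⟧ :=
  ∑ p ∈ antidiagonal n,
    (refinedBelow d (p.1 + 1) j + (refinedAll d p.1 - refinedBelow d p.1 j)) * invPochhammer d p.2

lemma refinedConvBelow_zero (d n : ℕ) : refinedConvBelow d n 0 = refinedConv d n := by
  simp [refinedConvBelow, refinedConv, refinedBelow_zero_right]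

lemma refinedConvBelow_succ {d : ℕ} (hd : 0 < d) (n j : ℕ) :
    refinedConvBelow d n (j + 1) = (1 + X ^ 2 ^ j * X ^ (d * n)) * refinedConvBelow d n j := by
  have h := sum_antidiagonal_sub_mul_invPochhammer hd
    (fun s => refinedBelow d s (j + 1) - refinedBelow d s j) n
  have e : ∑ p ∈ antidiagonal n, (refinedBelow d (p.1 + 1) (j + 1) - refinedBelow d (p.1 + 1) j) *
      (X ^ (d * p.2) * invPochhammer d p.2) =
        X ^ 2 ^ j * X ^ (d * n) * refinedConvBelow d n j := by
    rw [refinedConvBelow, mul_sum]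
    refine sum_congr rfl fun p hp => ?_
    rw [← mem_antidiagonal.1 hp, refinedBelow_succ_succ]
    ring
  rw [e] at h
  simp only [refinedBelow_zero_left, sub_self, zero_mul, add_zero] at h
  rw [add_mul, one_mul, ← h, refinedConvBelow, refinedConvBelow, ← sum_add_distrib]
  exact sum_congr rfl fun p _ => by ring

lemma refinedConvBelow_eq_prod {d : ℕ} (hd : 0 < d) (n j : ℕ) :
    refinedConvBelow d n j = (∏ i ∈ range j, (1 + X ^ 2 ^ i * X ^ (d * n))) * refinedConv d n := by
  induction j with
  | zero => simp [refinedConvBelow_zero]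
  | succ j ih => rw [refinedConvBelow_succ hd, ih, prod_range_succ]; ring

lemma refinedConvBelow_six {d : ℕ} (hd : 0 < d) (n : ℕ) :
    refinedConvBelow d n 6 = (1 - X ^ (d * (n + 1))) * refinedConv d (n + 1) -
      topResidues d * X ^ (d * n) * invPochhammer d n := by
  have h₁ := sum_antidiagonal_sub_mul_invPochhammer hd (fun s => refinedBelow d s 6) n
  have h₂ := sum_antidiagonal_sub_mul_invPochhammer hd (refinedAll d) n
  have h₃ : ∑ p ∈ antidiagonal n, refinedBelow d (p.1 + 1) 6 *
      (X ^ (d * p.2) * invPochhammer d p.2) =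
      ∑ p ∈ antidiagonal n, refinedAll d (p.1 + 1) * (X ^ (d * p.2) * invPochhammer d p.2) -
      X ^ (d * (n + 1)) * ∑ p ∈ antidiagonal n, refinedAll d (p.1 + 1) * invPochhammer d p.2 -
      topResidues d * X ^ (d * n) * invPochhammer d n := by
    have e : topResidues d * X ^ (d * n) * invPochhammer d n =
        ∑ p ∈ antidiagonal n, (if p.1 = 0 then topResidues d else 0) *
          (X ^ (d * p.2) * invPochhammer d p.2) := by
      rw [sum_eq_single (0, n)]
      · simp [mul_assoc]
      · rintro ⟨a, b⟩ hp hne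
        have : a ≠ 0 := by
          rintro rfl
          simp at hp
          simp [hp] at hne
        simp [this]
      · simp
    rw [e, mul_sum, ← sum_sub_distrib, ← sum_sub_distrib]
    refine sum_congr rfl fun p hp => ?_
    rw [← mem_antidiagonal.1 hp, refinedBelow_six hd]
    simp only [Nat.add_eq_right]
    ring
  have h₄ : refinedConv d (n + 1) = invPochhammer d (n + 1) +
      ∑ p ∈ antidiagonal n, refinedAll d (p.1 + 1) * invPochhammer d p.2 := by
    rw [refinedConv, Finset.Nat.sum_antidiagonal_succ, refinedAll_zero, one_mul]
  have h₅ := one_sub_mul_invPochhammer_succ hd n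
  have h₆ : refinedConvBelow d n 6 =
      ∑ p ∈ antidiagonal n, (refinedBelow d (p.1 + 1) 6 - refinedBelow d p.1 6) *
        invPochhammer d p.2 + refinedConv d n := by
    rw [refinedConvBelow, refinedConv, ← sum_add_distrib]
    exact sum_congr rfl fun p _ => by ring
  simp only [refinedBelow_zero_left, refinedAll_zero, zero_mul, add_zero, one_mul] at h₁ h₂
  rw [h₃, ← h₂] at h₁
  rw [h₆, h₁, h₄]
  simp only [sub_mul, sum_sub_distrib, refinedConv] at h₅ ⊢
  linear_combination (-1 : ℤ⟦X⟧) * h₅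

/-- `refinedConv d n` with the denominators cleared. -/
noncomputable def refinedPoly (d n : ℕ) : ℤ⟦X⟧ :=
  (∏ i ∈ range n, (1 - X ^ (d * (i + 1)))) * refinedConv d n

lemma refinedPoly_zero (d : ℕ) : refinedPoly d 0 = 1 := by
  simp [refinedPoly, refinedConv, refinedAll_zero, invPochhammer]

lemma refinedPoly_succ {d : ℕ} (hd : 0 < d) (n : ℕ) :
    refinedPoly d (n + 1) = (∏ i ∈ range 6, (1 + X ^ 2 ^ i * X ^ (d * n))) * refinedPoly d n +
      topResidues d * X ^ (d * n) := by
  have h := refinedConvBelow_six hd n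
  rw [refinedConvBelow_eq_prod hd] at h
  rw [refinedPoly, refinedPoly, prod_range_succ]
  linear_combination (-∏ i ∈ range n, (1 - X ^ (d * (i + 1)))) * h
    + topResidues d * X ^ (d * n) * pochhammer_mul_invPochhammer hd n

lemma refinedPoly_one {d : ℕ} (hd : 63 ≤ d) :
    refinedPoly d 1 = ∑ i ∈ range (d + 1), X ^ i := by
  rw [refinedPoly_succ (by omega), refinedPoly_zero, topResidues,
    ← sum_range_add_sum_Ico _ (show 64 ≤ d + 1 by omega)]
  simp only [prod_range_succ, sum_range_succ, range_zero, prod_empty, sum_empty, mul_zero,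
    pow_zero, mul_one]
  ring

lemma CoeffNonneg.one_add_X_pow_mul_X_pow (a b : ℕ) :
    CoeffNonneg (1 + X ^ a * X ^ b) :=
  one.add ((X_pow _).mul (X_pow _))

lemma prod_le_refinedPoly {d : ℕ} (hd : 63 ≤ d) (n : ℕ) :
    CoeffNonneg (refinedPoly d (n + 1) -
      (∏ l ∈ range n, ∏ i ∈ range 6, (1 + X ^ 2 ^ i * X ^ (d * (l + 1)))) *
        ∑ i ∈ range (d + 1), X ^ i) := by
  induction n with
  | zero => simpa [refinedPoly_one hd] using CoeffNonneg.zero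
  | succ n ih =>
    have hP : CoeffNonneg (∏ i ∈ range 6, (1 + X ^ 2 ^ i * X ^ (d * (n + 1)))) :=
      CoeffNonneg.prod _ fun i _ => CoeffNonneg.one_add_X_pow_mul_X_pow _ _
    have hT : CoeffNonneg (topResidues d * X ^ (d * (n + 1))) :=
      (CoeffNonneg.sum _ fun i _ => CoeffNonneg.X_pow i).mul (CoeffNonneg.X_pow _)
    convert (hP.mul ih).add hT using 1
    rw [refinedPoly_succ (by omega), prod_range_succ _ n]
    ring

lemma X_pow_dvd_refined {d : ℕ} (s : ℕ) :
    X ^ s ∣ refinedAll d s ∧ ∀ j, X ^ s ∣ refinedBelow d s j := by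
  induction s with
  | zero => simp
  | succ s ih =>
    have h : ∀ j, X ^ (s + 1) ∣ refinedBelow d (s + 1) j := by
      intro j
      induction j with
      | zero => simp [refinedBelow_zero_right]
      | succ j ihj =>
        rw [refinedBelow_succ_succ, mul_add, ← add_assoc]
        refine dvd_add (dvd_add ihj (ihj.mul_left _)) ?_
        rw [pow_succ', mul_assoc]
        exact mul_dvd_mul (dvd_pow_self _ (by positivity))
          ((dvd_sub ih.1 (ih.2 j)).mul_left _)
    refine ⟨?_, h⟩
    rw [refinedAll_succ]
    refine (dvd_add (h 6) ?_).mul_right _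
    split_ifs with h0
    · subst h0
      exact dvd_sum fun i hi => pow_dvd_pow _ (by have := mem_Ico.1 hi; omega)
    · exact dvd_zero _

lemma X_pow_dvd_pochhammer_mul_invPochhammer_sub_one {d : ℕ} (hd : 0 < d) (m s : ℕ) :
    X ^ (m + 1) ∣
      (∏ i ∈ range (m + s), (1 - X ^ (d * (i + 1)))) * invPochhammer d m - (1 : ℤ⟦X⟧) := by
  induction s with
  | zero => simp [pochhammer_mul_invPochhammer hd]
  | succ s ih =>
    rw [← add_assoc, prod_range_succ]
    have h : (X : ℤ⟦X⟧) ^ (m + 1) ∣ X ^ (d * (m + s + 1)) := pow_dvd_pow _ (by nlinarith)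
    convert dvd_sub ih (h.mul_right
      ((∏ i ∈ range (m + s), (1 - X ^ (d * (i + 1)))) * invPochhammer d m)) using 1
    ring

lemma coeff_refinedPoly {d : ℕ} (hd : 0 < d) (N : ℕ) :
    coeff N (refinedPoly d (2 * N + 1)) = ∑ s ∈ range (N + 1), coeff N (refinedAll d s) := by
  rw [refinedPoly, refinedConv, Finset.Nat.sum_antidiagonal_eq_sum_range_succ
    (fun s m => refinedAll d s * invPochhammer d m), mul_sum, map_sum,
    ← sum_subset (range_subset_range.2 (by omega : N + 1 ≤ (2 * N + 1).succ))]
  · refine sum_congr rfl fun s hs => ?_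
    have hs : s ≤ N := Nat.lt_succ_iff.1 (mem_range.1 hs)
    have h := X_pow_dvd_pochhammer_mul_invPochhammer_sub_one hd (2 * N + 1 - s) s
    rw [Nat.sub_add_cancel (by omega)] at h
    have h' := X_pow_dvd_iff.1 (h.mul_left (refinedAll d s)) N (by omega)
    rw [mul_sub, map_sub, mul_one, sub_eq_zero] at h'
    rw [← h']
    ring_nf
  · intro s _ hs
    refine X_pow_dvd_iff.1 ?_ N (by simpa using hs : N < s)
    exact ((X_pow_dvd_refined s).1.mul_right _).mul_left _

/-- The increasing lists of `s` numbers `≥ b` with sum `N` and consecutive gaps at least `d`. -/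
def gapLists (d : ℕ) : ℕ → ℕ → ℕ → Finset (List ℕ)
  | 0, _, N => if N = 0 then {[]} else ∅
  | s + 1, b, N => ((range (N + 1)).filter (b + · ≤ N)).biUnion fun i =>
      (gapLists d s (b + i + d) (N - (b + i))).image (List.cons (b + i))

lemma card_gapLists (d s b N : ℕ) : ((gapLists d s b N).card : ℤ) = coeff N (gapSeries d s b) := by
  induction s generalizing b N with
  | zero => rw [gapSeries_zero, coeff_one, gapLists]; split_ifs <;> simp
  | succ s ih =>
    have tail : coeff N (gapSeries d (s + 1) (b + (N + 1))) = 0 := by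
      rw [gapSeries_add, coeff_X_pow_mul', if_neg (by nlinarith)]
    have expand := congrArg (coeff N) (gapSeries_succ_sub_eq_sum d s b (N + 1))
    rw [map_sub, tail, sub_zero, map_sum] at expand
    rw [expand, gapLists, card_biUnion, Nat.cast_sum, sum_filter]
    · refine sum_congr rfl fun i _ => ?_
      rw [coeff_X_pow_mul', card_image_of_injective _ List.cons_injective, ih]
    · intro i _ j _ hij
      rw [Function.onFun, disjoint_left]
      intro l hl hl'
      obtain ⟨u, -, rfl⟩ := mem_image.1 hl
      obtain ⟨v, -, huv⟩ := mem_image.1 hl'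
      have := (List.cons.inj huv).1
      omega

lemma mem_gapLists {d s b N : ℕ} {l : List ℕ} (hl : l ∈ gapLists d s b N) :
    l.length = s ∧ l.sum = N ∧ (∀ x ∈ l, b ≤ x) ∧ l.Pairwise (fun x y => x + d ≤ y) := by
  induction s generalizing b N l with
  | zero =>
    rw [gapLists] at hl
    split_ifs at hl with h
    · simp_all
    · simp at hl
  | succ s ih =>
    simp only [gapLists, mem_biUnion, mem_filter, mem_image] at hl
    obtain ⟨i, ⟨-, hi⟩, u, hu, rfl⟩ := hl
    obtain ⟨h₁, h₂, h₃, h₄⟩ := ih hu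
    refine ⟨by simp [h₁], by rw [List.sum_cons, h₂]; omega, ?_, ?_⟩
    · intro x hx
      rcases List.mem_cons.1 hx with rfl | hx
      · omega
      · have := h₃ x hx; omega
    · exact List.pairwise_cons.2 ⟨h₃, h₄⟩

lemma sum_coeff_gapSeries_le_qpart {d : ℕ} (hd : 0 < d) (N : ℕ) :
    ∑ s ∈ range (N + 1), coeff N (gapSeries d s 1) ≤ (qpart 1 d N : ℤ) := by
  set U := (range (N + 1)).biUnion fun s => gapLists d s 1 N
  have hU : ∀ l ∈ U, l.sum = N ∧ (∀ x ∈ l, 1 ≤ x) ∧ l.Pairwise (fun x y => x + d ≤ y) := by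
    intro l hl
    obtain ⟨s, -, hs⟩ := mem_biUnion.1 hl
    exact (mem_gapLists hs).2
  have cardU : (U.card : ℤ) = ∑ s ∈ range (N + 1), coeff N (gapSeries d s 1) := by
    rw [card_biUnion, Nat.cast_sum]
    · exact sum_congr rfl fun s _ => card_gapLists d s 1 N
    · intro s _ t _ hst
      rw [Function.onFun, disjoint_left]
      exact fun l hl hl' => hst ((mem_gapLists hl).1.symm.trans (mem_gapLists hl').1)
  have gap : ∀ l ∈ U, ∀ x ∈ l, ∀ y ∈ l, x ≠ y → d ≤ max x y - min x y := by
    intro l hl x hx y hy hxy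
    exact List.Pairwise.forall_of_forall_of_flip (R := fun x y => x ≠ y → d ≤ max x y - min x y)
      (fun _ _ h => absurd rfl h) ((hU l hl).2.2.imp fun {x y} h _ => by omega)
      ((hU l hl).2.2.imp fun {x y} h _ => by omega) hx hy hxy
  rw [← cardU, Nat.cast_le, qpart, ← Fintype.card_coe, ← Nat.card_eq_fintype_card]
  refine Nat.card_le_card_of_injective (fun l : U => ⟨⟨(l.1 : Multiset ℕ),
    fun {x} hx => (hU l l.2).2.1 x hx, by simpa using (hU l l.2).1⟩,
      fun x hx => (hU l l.2).2.1 x hx, fun x _ => ?_, fun x hx y hy => gap l l.2 x hx y hy⟩) ?_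
  · have : (l.1 : List ℕ).Nodup := (hU l l.2).2.2.imp fun {x y} h => by omega
    exact Multiset.nodup_iff_count_le_one.1 (Multiset.coe_nodup.2 this) x
  · intro l l' h
    have perm : (l.1 : Multiset ℕ) = l'.1 := congrArg (fun p => p.1.parts) h
    exact Subtype.ext ((Multiset.coe_eq_coe.1 perm).eq_of_pairwise
      (fun a b _ _ h₁ h₂ => by omega) (hU l l.2).2.2 (hU l' l'.2).2.2)

/-- The size of the item of level `x.1 + 1` and colour `x.2`. -/
def itemSize (d : ℕ) (x : ℕ × ℕ) : ℕ := 2 ^ x.2 + d * (x.1 + 1)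

lemma coeff_prod_mul_sum (d n N : ℕ) :
    coeff N ((∏ l ∈ range n, ∏ i ∈ range 6, (1 + X ^ 2 ^ i * X ^ (d * (l + 1)))) *
      ∑ i ∈ range (d + 1), X ^ i : ℤ⟦X⟧) =
    (((range n ×ˢ range 6).powerset.filter fun S =>
      ∑ x ∈ S, itemSize d x ≤ N ∧ N ≤ ∑ x ∈ S, itemSize d x + d).card : ℤ) := by
  have expand : (∏ l ∈ range n, ∏ i ∈ range 6, (1 + X ^ 2 ^ i * X ^ (d * (l + 1))) : ℤ⟦X⟧) =
      ∑ S ∈ (range n ×ˢ range 6).powerset, X ^ ∑ x ∈ S, itemSize d x := by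
    rw [← prod_product' (range n) (range 6)
      (fun l i => (1 + X ^ 2 ^ i * X ^ (d * (l + 1)) : ℤ⟦X⟧)), prod_one_add]
    refine sum_congr rfl fun S _ => ?_
    rw [← prod_pow_eq_pow_sum]
    exact prod_congr rfl fun x _ => by rw [itemSize, pow_add]
  rw [expand, sum_mul, map_sum, card_filter, Nat.cast_sum]
  refine sum_congr rfl fun S _ => ?_
  rw [coeff_X_pow_mul', map_sum]
  simp only [coeff_X_pow, sum_ite_eq, mem_range]
  split_ifs <;> simp <;> omega

/-- The elements of `T5 d` other than `1`. -/
def bigPart (d : ℕ) (x : ℕ × ℕ) : ℕ :=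
  if x.2 = 0 then 2 * d * (x.1 + 1) + 1 else 2 * d * x.1 + d + 2 ^ x.2

/-- The item standing for `2 ^ f` copies of `bigPart d x`. -/
def partItem (x : ℕ × ℕ) (f : ℕ) : ℕ × ℕ :=
  (if x.2 = 0 then 2 ^ f * (2 * x.1 + 1) else 2 ^ f * (2 * x.1 + 1) - 1, x.2)

lemma itemSize_partItem_le (d : ℕ) (x : ℕ × ℕ) (f : ℕ) :
    itemSize d (partItem x f) ≤ 2 ^ f * bigPart d x := by
  obtain ⟨k, j⟩ := x
  have hf : 1 ≤ 2 ^ f := Nat.one_le_two_pow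
  simp only [itemSize, partItem, bigPart]
  split_ifs with h
  · subst h
    nlinarith [Nat.mul_le_mul_left d hf]
  · have pos : 0 < 2 ^ f * (2 * k + 1) := by positivity
    rw [Nat.sub_add_cancel pos]
    nlinarith [Nat.mul_le_mul_right (2 ^ j) hf]

lemma two_pow_mul_odd_inj {f g k l : ℕ} (h : 2 ^ f * (2 * k + 1) = 2 ^ g * (2 * l + 1)) :
    f = g ∧ k = l := by
  induction f generalizing g with
  | zero =>
    cases g with
    | zero => simp at h; exact ⟨rfl, h⟩
    | succ g => rw [pow_succ] at h; ring_nf at h; omega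
  | succ f ih =>
    cases g with
    | zero => rw [pow_succ] at h; ring_nf at h; omega
    | succ g =>
      have := @ih g (by rw [pow_succ, pow_succ] at h; nlinarith)
      omega

lemma partItem_inj {x y : ℕ × ℕ} {f g : ℕ} (h : partItem x f = partItem y g) : x = y ∧ f = g := by
  obtain ⟨k, j⟩ := x
  obtain ⟨l, i⟩ := y
  simp only [partItem, Prod.mk.injEq] at h
  obtain ⟨h, rfl⟩ := h
  have pos₁ : 0 < 2 ^ f * (2 * k + 1) := by positivity
  have pos₂ : 0 < 2 ^ g * (2 * l + 1) := by positivity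
  have := two_pow_mul_odd_inj (f := f) (g := g) (k := k) (l := l) (by split_ifs at h <;> omega)
  simp [this]

lemma bigPart_injOn {d : ℕ} (hd : 63 ≤ d) (N : ℕ) :
    Set.InjOn (bigPart d) (range N ×ˢ range 5 : Finset (ℕ × ℕ)) := by
  have key : ∀ k j, j < 5 → ∃ r < 2 * d,
      bigPart d (k, j) = 2 * d * (if j = 0 then k + 1 else k) + r ∧
        r = if j = 0 then 1 else d + 2 ^ j := by
    intro k j hj
    refine ⟨_, ?_, ?_, rfl⟩
    · interval_cases j <;> simp <;> omega
    · simp only [bigPart]; split_ifs <;> ring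
  rintro ⟨k, j⟩ hx ⟨l, i⟩ hy h
  simp only [coe_product, Set.mem_prod, mem_coe, mem_range] at hx hy
  obtain ⟨r, hr, e₁, e₂⟩ := key k j hx.2
  obtain ⟨s, hs, e₃, e₄⟩ := key l i hy.2
  rw [e₁, e₃] at h
  have hmod := congrArg (· % (2 * d)) h
  have hdiv := congrArg (· / (2 * d)) h
  simp only [Nat.mul_add_mod, Nat.mod_eq_of_lt hr, Nat.mod_eq_of_lt hs] at hmod
  simp only [Nat.mul_add_div (show 2 * d > 0 by omega), Nat.div_eq_of_lt hr,
    Nat.div_eq_of_lt hs] at hdiv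
  obtain ⟨-, hj⟩ := hx
  obtain ⟨-, hi⟩ := hy
  interval_cases j <;> interval_cases i <;> simp at * <;> omega

lemma exists_bigPart {d t : ℕ} (hd : 63 ≤ d) (ht : t ∈ T5 d) (h1 : t ≠ 1) :
    ∃ k, ∃ j < 5, t = bigPart d (k, j) := by
  have hdiv := Nat.div_add_mod t (2 * d)
  rcases ht with h | ⟨j, hj₁, hj₂, h⟩
  · rw [Nat.mod_eq_of_lt (show 1 < 2 * d by omega)] at h
    rcases Nat.eq_zero_or_pos (t / (2 * d)) with h0 | h0
    · rw [h0, h] at hdiv; omega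
    · refine ⟨t / (2 * d) - 1, 0, by norm_num, ?_⟩
      simp only [bigPart, if_true]
      rw [Nat.sub_add_cancel h0]; omega
  · have hlt : d + 2 ^ j < 2 * d := by
      have : j < 5 := by omega
      interval_cases j <;> omega
    rw [Nat.mod_eq_of_lt hlt] at h
    refine ⟨t / (2 * d), j, by omega, ?_⟩
    simp only [bigPart, if_neg (show j ≠ 0 by omega)]
    omega

lemma lt_bigPart {d : ℕ} (hd : 0 < d) (x : ℕ × ℕ) : x.1 < bigPart d x := by
  simp only [bigPart]
  split_ifs
  · nlinarith
  · nlinarith [Nat.one_le_two_pow (n := x.2)]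

/-- The items encoding the parts other than `1` of a partition of `N` into elements of `T5 d`:
the multiplicity of each part is written in binary. -/
def partItems (d : ℕ) {N : ℕ} (p : N.Partition) : Finset (ℕ × ℕ) :=
  (range N ×ˢ range 5).biUnion fun x =>
    (p.parts.count (bigPart d x)).bitIndices.toFinset.image (partItem x)

lemma partItem_mem_partItems {d N : ℕ} (p : N.Partition) {x : ℕ × ℕ}
    (hx : x ∈ range N ×ˢ range 5) (f : ℕ) :
    partItem x f ∈ partItems d p ↔ f ∈ (p.parts.count (bigPart d x)).bitIndices.toFinset := by
  simp only [partItems, mem_biUnion, mem_image]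
  constructor
  · rintro ⟨y, -, g, hg, h⟩
    obtain ⟨rfl, rfl⟩ := partItem_inj h
    exact hg
  · exact fun h => ⟨x, hx, f, h, rfl⟩

lemma sum_partItems_le {d : ℕ} (hd : 63 ≤ d) {N : ℕ} (p : N.Partition) :
    ∑ x ∈ partItems d p, itemSize d x ≤ N := by
  rw [partItems, sum_biUnion]
  · calc
      _ ≤ ∑ x ∈ range N ×ˢ range 5, p.parts.count (bigPart d x) • bigPart d x := by
        refine sum_le_sum fun x _ => ?_
        rw [sum_image fun f _ g _ h => (partItem_inj h).2, smul_eq_mul]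
        nth_rw 2 [← sum_toFinset_bitIndices_two_pow (p.parts.count (bigPart d x))]
        rw [sum_mul]
        exact sum_le_sum fun f _ => itemSize_partItem_le d x f
      _ = ∑ t ∈ (range N ×ˢ range 5).image (bigPart d), p.parts.count t • t :=
        (sum_image (f := fun t => p.parts.count t • t) (bigPart_injOn hd N)).symm
      _ ≤ ∑ t ∈ p.parts.toFinset, p.parts.count t • t := by
        refine sum_le_sum_of_ne_zero fun t _ h => ?_
        by_contra hc
        simp_all
      _ = N := by rw [← sum_multiset_count, p.parts_sum]
  · intro x _ y _ hxy
    rw [Function.onFun, disjoint_left]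
    intro z hz hz'
    obtain ⟨f, -, rfl⟩ := mem_image.1 hz
    obtain ⟨g, -, h⟩ := mem_image.1 hz'
    exact hxy (partItem_inj h).1.symm

lemma mem_partItems {d N : ℕ} {p : N.Partition} {x : ℕ × ℕ} (hx : x ∈ partItems d p) :
    x ≠ (0, 0) ∧ x.2 < 5 := by
  simp only [partItems, mem_biUnion, mem_image, mem_product, mem_range] at hx
  obtain ⟨⟨k, j⟩, ⟨-, hj⟩, f, -, rfl⟩ := hx
  refine ⟨fun h => ?_, hj⟩
  simp only [partItem, Prod.mk.injEq] at h
  obtain ⟨h, rfl⟩ := h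
  simp at h

lemma partItems_inj {d : ℕ} (hd : 63 ≤ d) {N : ℕ} {p q : N.Partition}
    (hp : ∀ x ∈ p.parts, x ∈ T5 d) (hq : ∀ x ∈ q.parts, x ∈ T5 d)
    (h : partItems d p = partItems d q) : p = q := by
  have large : ∀ (p : N.Partition) t, N < t → p.parts.count t = 0 := fun p t ht =>
    Multiset.count_eq_zero.2 fun hm =>
      absurd (Multiset.le_sum_of_mem hm) (by rw [p.parts_sum]; omega)
  have counts : ∀ t, t ≠ 1 → p.parts.count t = q.parts.count t := by
    intro t h1
    by_cases ht : t ∈ T5 d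
    · obtain ⟨k, j, hj, rfl⟩ := exists_bigPart hd ht h1
      rcases lt_or_ge k N with hk | hk
      · have hx : (k, j) ∈ range N ×ˢ range 5 := by simp [hk, hj]
        rw [← sum_toFinset_bitIndices_two_pow (p.parts.count _),
          ← sum_toFinset_bitIndices_two_pow (q.parts.count _)]
        refine sum_congr (Finset.ext fun f => ?_) fun _ _ => rfl
        rw [← partItem_mem_partItems p hx, ← partItem_mem_partItems q hx, h]
      · have := lt_bigPart (d := d) (by omega) (k, j)
        rw [large p _ (by simp at this; omega), large q _ (by simp at this; omega)]
    · rw [Multiset.count_eq_zero.2 fun hm => ht (hp t hm),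
        Multiset.count_eq_zero.2 fun hm => ht (hq t hm)]
  have rest : p.parts.filter (¬ · = 1) = q.parts.filter (¬ · = 1) := by
    ext t
    rw [Multiset.count_filter, Multiset.count_filter]
    split_ifs with h1
    · rfl
    · exact counts t h1
  have sums : ∀ p : N.Partition, p.parts.count 1 + (p.parts.filter (¬ · = 1)).sum = N := by
    intro p
    have := congrArg Multiset.sum (Multiset.filter_add_not (· = 1) p.parts)
    rw [Multiset.sum_add, Multiset.filter_eq', Multiset.sum_replicate, p.parts_sum] at this
    simpa using this
  ext t
  by_cases h1 : t = 1
  · have h₁ := sums p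
    have h₂ := sums q
    rw [rest] at h₁
    subst h1
    omega
  · exact counts t h1

/-- Items filling up a deficit of `s` to a deficit of at most `d`. -/
def filler (d s : ℕ) : Finset (ℕ × ℕ) :=
  if s ≤ d then ∅ else if s ≤ d + 31 then {(0, 0)} else {((s - 32) / d - 1, 5)}

lemma mem_filler {d s : ℕ} {x : ℕ × ℕ} (hx : x ∈ filler d s) : ¬ (x ≠ (0, 0) ∧ x.2 < 5) := by
  rw [filler] at hx
  split_ifs at hx <;> simp_all

lemma sum_filler {d : ℕ} (hd : 63 ≤ d) (s : ℕ) :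
    ∑ x ∈ filler d s, itemSize d x ≤ s ∧ s ≤ ∑ x ∈ filler d s, itemSize d x + d := by
  rw [filler]
  split_ifs with h₁ h₂
  · simpa using h₁
  · simp only [sum_singleton, itemSize]; omega
  · have pos : 0 < (s - 32) / d := Nat.div_pos (by omega) (by omega)
    have h₃ := Nat.div_add_mod (s - 32) d
    have h₄ := Nat.mod_lt (s - 32) (show d > 0 by omega)
    simp only [sum_singleton, itemSize, Nat.sub_add_cancel pos]
    omega

lemma rho_T5_le_coeff {d : ℕ} (hd : 63 ≤ d) (N : ℕ) :
    (rho (T5 d) N : ℤ) ≤ coeff N ((∏ l ∈ range (2 * N), ∏ i ∈ range 6,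
      (1 + X ^ 2 ^ i * X ^ (d * (l + 1)))) * ∑ i ∈ range (d + 1), X ^ i : ℤ⟦X⟧) := by
  set deficit : N.Partition → ℕ := fun p => N - ∑ x ∈ partItems d p, itemSize d x with hdef
  have sum_eq : ∀ p : N.Partition,
      ∑ x ∈ partItems d p ∪ filler d (deficit p), itemSize d x =
        ∑ x ∈ partItems d p, itemSize d x + ∑ x ∈ filler d (deficit p), itemSize d x :=
    fun p => sum_union (disjoint_left.2 fun x hx hx' => mem_filler hx' (mem_partItems hx))
  have sum_le : ∀ p : N.Partition,
      ∑ x ∈ partItems d p ∪ filler d (deficit p), itemSize d x ≤ N := by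
    intro p
    have h₁ := (sum_filler hd (deficit p)).1
    have h₂ := sum_partItems_le hd p
    rw [sum_eq]
    simp only [hdef] at h₁ ⊢
    omega
  rw [coeff_prod_mul_sum, Nat.cast_le, rho, ← Fintype.card_coe, ← Nat.card_eq_fintype_card]
  refine Nat.card_le_card_of_injective
    (fun p => ⟨partItems d p.1 ∪ filler d (deficit p.1), ?_⟩) ?_
  · refine mem_filter.2 ⟨mem_powerset.2 fun x hx => ?_, sum_le p.1, ?_⟩
    · have hsize : itemSize d x ≤ N :=
        (single_le_sum (f := itemSize d) (fun _ _ => Nat.zero_le _) hx).trans (sum_le p.1)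
      have hlevel : x.1 < 2 * N := by
        have := Nat.le_mul_of_pos_left (x.1 + 1) (show 0 < d by omega)
        have := (Nat.le_add_left _ _).trans hsize
        omega
      have hcolour : x.2 < 6 := by
        rcases mem_union.1 hx with h | h
        · exact (mem_partItems h).2.trans (by norm_num)
        · rw [filler] at h
          split_ifs at h <;> simp_all
      simp [hlevel, hcolour]
    · have h₁ := (sum_filler hd (deficit p.1)).2
      have h₂ := sum_partItems_le hd p.1
      rw [sum_eq]
      simp only [hdef] at h₁ ⊢
      omega
  · intro p q h
    have recover : ∀ p : N.Partition, (partItems d p ∪ filler d (deficit p)).filter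
        (fun x => x ≠ (0, 0) ∧ x.2 < 5) = partItems d p := fun p => by
      rw [filter_union, filter_true_of_mem fun x hx => mem_partItems hx,
        filter_false_of_mem fun x hx => mem_filler hx, union_empty]
    refine Subtype.ext (partItems_inj hd p.2 q.2 ?_)
    have union_eq : partItems d p.1 ∪ filler d (deficit p.1) =
        partItems d q.1 ∪ filler d (deficit q.1) := congrArg Subtype.val h
    rw [← recover p.1, ← recover q.1, union_eq]

theorem stmt12 (d n : ℕ) (hd : 63 ≤ d) (hn : 5 * d ≤ n) :
    rho (T5 d) n ≤ qpart 1 d n := by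
  have hd₀ : 0 < d := by omega
  have hprod := prod_le_refinedPoly hd (2 * n) n
  rw [map_sub, sub_nonneg, coeff_refinedPoly hd₀] at hprod
  have hgap : ∑ s ∈ range (n + 1), coeff n (refinedAll d s) ≤
      ∑ s ∈ range (n + 1), coeff n (gapSeries d s 1) := sum_le_sum fun s _ => by
    have := (refined_le_gapSeries hd s).1 n
    rwa [map_sub, sub_nonneg] at this
  exact_mod_cast (rho_T5_le_coeff hd n).trans
    (hprod.trans (hgap.trans (sum_coeff_gapSeries_le_qpart hd₀ n)))
end
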